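/- arXiv:1804.01664 — 3 statements merged into one kernel-verified Lean document; each statement's English description precedes it below -/
import Mathlib

section
/- Let σ and σ′ be irreducible representations of G_n(𝔽) such that σ is ψ-generic and σ′ is ψ⁻¹-generic, with Bessel functions J_{σ,ψ} and J_{σ′,ψ⁻¹}. If σ′ is not isomorphic to the contragredient σ̃ of σ, then Σ_{g ∈ U_n(𝔽)\G_n(𝔽)} J_{σ,ψ}(g)·J_{σ′,ψ⁻¹}(g) = 0. -/
open scoped BigOperators
open scoped Classical

noncomputable section

/-- `GL_n(F)` as the general linear group of `n × n` matrices over `F`. -/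
abbrev GLn (n : ℕ) (F : Type) [Field F] : Type := Matrix.GeneralLinearGroup (Fin n) F

variable {F : Type} [Field F] [Fintype F] [DecidableEq F]

/-- `u` is an upper triangular unipotent matrix. -/
def IsUnipUT {n : ℕ} (u : GLn n F) : Prop :=
  (∀ i : Fin n, (u : Matrix (Fin n) (Fin n) F) i i = 1) ∧
    ∀ i j : Fin n, j < i → (u : Matrix (Fin n) (Fin n) F) i j = 0

/-- The sum of the superdiagonal entries `u_{12} + u_{23} + ⋯ + u_{n-1,n}`. -/
def superdiag {n : ℕ} (u : GLn n F) : F :=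
  ∑ i : Fin n, ∑ j : Fin n,
    if (j : ℕ) = (i : ℕ) + 1 then (u : Matrix (Fin n) (Fin n) F) i j else 0

/-- The extension of the additive character `ψ` to unipotent matrices:
`ψ(u) = ψ(u_{12} + u_{23} + ⋯ + u_{n-1,n})`. -/
def psiU {n : ℕ} (ψ : AddChar F ℂ) (u : GLn n F) : ℂ :=
  ψ (superdiag u)

/-- The number of elements of `U_n(F)`, the upper triangular unipotent subgroup. -/
def unipCount (n : ℕ) (F : Type) [Field F] [Fintype F] [DecidableEq F] : ℕ :=
  Fintype.card {u : GLn n F // IsUnipUT u}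

/-- A sum over `U_n(F)\G_n(F)` of a left-`U_n(F)`-invariant summand, i.e. `|U_n(F)|⁻¹`
times the sum over all of `G_n(F)`. -/
def cosetSum {n : ℕ} (f : GLn n F → ℂ) : ℂ :=
  (unipCount n F : ℂ)⁻¹ * ∑ g : GLn n F, f g

/-- The Bessel function of a representation `σ` w.r.t. `ψ`:
`J_{σ,ψ}(g) = |U_n(F)|⁻¹ ∑_{u ∈ U_n(F)} ψ(u⁻¹) tr σ(g u)`. -/
def Bessel {n : ℕ} {V : Type} [AddCommGroup V] [Module ℂ V] (ψ : AddChar F ℂ)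
    (σ : Representation ℂ (GLn n F) V) (g : GLn n F) : ℂ :=
  (unipCount n F : ℂ)⁻¹ *
    ∑ u : GLn n F, if IsUnipUT u then psiU ψ u⁻¹ * LinearMap.trace ℂ V (σ (g * u)) else 0

/-- Irreducibility of a representation: the space is nonzero and the only invariant
subspaces are `⊥` and `⊤`. -/
def IsIrred {G : Type} [Group G] {V : Type} [AddCommGroup V] [Module ℂ V]
    (σ : Representation ℂ G V) : Prop :=
  Nontrivial V ∧
    ∀ U : Submodule ℂ V, (∀ g : G, ∀ v ∈ U, σ g v ∈ U) → U = ⊥ ∨ U = ⊤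

/-- Membership in the standard (block upper triangular) unipotent subgroup attached to the
composition of `n` encoded by the monotone block-index function `c : Fin n → ℕ`:
diagonal blocks are identity and entries below the block diagonal vanish. -/
def InStdUnip {n : ℕ} (c : Fin n → ℕ) (u : GLn n F) : Prop :=
  (∀ i j : Fin n, c i = c j →
      (u : Matrix (Fin n) (Fin n) F) i j = if i = j then 1 else 0) ∧
    ∀ i j : Fin n, c j < c i → (u : Matrix (Fin n) (Fin n) F) i j = 0

/-- A representation of `G_n(F)` is cuspidal if it is irreducible and
`∑_{u ∈ U'} σ(u) = 0` for every nontrivial standard unipotent subgroup `U'`. -/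
def IsCuspidal {n : ℕ} {V : Type} [AddCommGroup V] [Module ℂ V]
    (σ : Representation ℂ (GLn n F) V) : Prop :=
  IsIrred σ ∧
    ∀ c : Fin n → ℕ, Monotone c → (∃ i j, c i ≠ c j) →
      (∑ u : GLn n F, if InStdUnip c u then σ u else (0 : V →ₗ[ℂ] V)) = 0

/-- `W` belongs to the Whittaker model `𝒲(σ, ψ)`: it has the form `W(g) = L(σ(g)v)` for a
vector `v` and a linear functional `L` with `L(σ(u)w) = ψ(u)·L(w)` for unipotent `u`. -/
def IsWhittaker {n : ℕ} {V : Type} [AddCommGroup V] [Module ℂ V] (ψ : AddChar F ℂ)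
    (σ : Representation ℂ (GLn n F) V) (W : GLn n F → ℂ) : Prop :=
  ∃ (L : V →ₗ[ℂ] ℂ) (v : V),
    (∀ u : GLn n F, IsUnipUT u → ∀ w : V, L (σ u w) = psiU ψ u * L w) ∧
      ∀ g : GLn n F, W g = L (σ g v)

/-- Isomorphism of representations. -/
def RepIso {G : Type} [Group G] {V W : Type} [AddCommGroup V] [Module ℂ V]
    [AddCommGroup W] [Module ℂ W]
    (σ : Representation ℂ G V) (τ : Representation ℂ G W) : Prop :=
  ∃ e : V ≃ₗ[ℂ] W, ∀ (g : G) (v : V), e (σ g v) = τ g (e v)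

/-- The space of `(U_n(F), ψ)`-eigenvectors of `σ`. -/
def whittakerVectors {n : ℕ} {V : Type} [AddCommGroup V] [Module ℂ V] (ψ : AddChar F ℂ)
    (σ : Representation ℂ (GLn n F) V) : Submodule ℂ V where
  carrier := {v | ∀ u : GLn n F, IsUnipUT u → σ u v = psiU ψ u • v}
  add_mem' := by
    intro a b ha hb u hu
    simp only [Set.mem_setOf_eq] at *
    simp [map_add, ha u hu, hb u hu, smul_add]
  zero_mem' := by
    intro u hu
    simp
  smul_mem' := by
    intro c a ha u hu
    simp only [Set.mem_setOf_eq] at *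
    rw [map_smul, ha u hu]
    exact smul_comm _ _ _

/-- `σ` is `ψ`-generic: `ψ` occurs with multiplicity exactly one in `σ|_{U_n(F)}`. -/
def IsGeneric {n : ℕ} {V : Type} [AddCommGroup V] [Module ℂ V] (ψ : AddChar F ℂ)
    (σ : Representation ℂ (GLn n F) V) : Prop :=
  Module.finrank ℂ (whittakerVectors ψ σ) = 1

/-- The standard basis row vector with a `1` in position `k` (0-indexed). -/
def eVec (n : ℕ) (F : Type) [Field F] (k : ℕ) : Fin n → F :=
  fun i => if (i : ℕ) = k then 1 else 0

/-- The finite Fourier transform `φ̂(x) = ∑_y φ(y) ψ(∑ i, x i * y i)`. -/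
def fourierF {n : ℕ} (ψ : AddChar F ℂ) (φ : (Fin n → F) → ℂ) (x : Fin n → F) : ℂ :=
  ∑ y : Fin n → F, φ y * ψ (∑ i, x i * y i)

section MatrixCoefficients

variable {G : Type} [Group G] {V V' : Type} [AddCommGroup V] [Module ℂ V]
  [AddCommGroup V'] [Module ℂ V'] {σ : Representation ℂ G V} {σ' : Representation ℂ G V'}

/-- **Schur's lemma** for invariant pairings: a `G`-invariant pairing between irreducible
representations vanishes, unless each of them is the contragredient of the other. -/
theorem invariant_pairing_eq_zero [FiniteDimensional ℂ V] [FiniteDimensional ℂ V']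
    (hσ : IsIrred σ) (hσ' : IsIrred σ') (hniso : ¬ RepIso σ' σ.dual)
    (T : V' →ₗ[ℂ] Module.Dual ℂ V) (hT : ∀ g v' v, T (σ' g v') (σ g v) = T v' v) : T = 0 := by
  have hT' : ∀ g v' v, T (σ' g v') v = T v' (σ g⁻¹ v) := fun g v' v => by
    rw [← hT g v' (σ g⁻¹ v), Representation.self_inv_apply]
  rcases hσ'.2 T.ker fun g v' hv' => by
    rw [LinearMap.mem_ker] at hv' ⊢
    ext v
    simp [hT', hv'] with hker | hker
  swap
  · exact LinearMap.ker_eq_top.1 hker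
  rcases hσ.2 T.flip.ker fun g v hv => by
    rw [LinearMap.mem_ker] at hv ⊢
    ext v'
    have h := hT' g⁻¹ v' v
    rw [inv_inv] at h
    rw [LinearMap.flip_apply, ← h, ← LinearMap.flip_apply, hv]
    rfl with hflip | hflip
  swap
  · rw [← LinearMap.flip_flip T, LinearMap.ker_eq_top.1 hflip]
    rfl
  have hinj : Function.Injective T := LinearMap.ker_eq_bot.1 hker
  have hle := LinearMap.finrank_le_finrank_of_injective hinj
  have hge := LinearMap.finrank_le_finrank_of_injective (LinearMap.ker_eq_bot.1 hflip)
  rw [Subspace.dual_finrank_eq] at hle hge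
  have hdim : Module.finrank ℂ V' = Module.finrank ℂ (Module.Dual ℂ V) := by
    rw [Subspace.dual_finrank_eq]
    exact le_antisymm hle hge
  refine absurd ⟨LinearEquiv.ofInjectiveOfFinrankEq T hinj hdim, fun g v' => ?_⟩ hniso
  ext v
  exact hT' g v' v

variable [Fintype G] [FiniteDimensional ℂ V] [FiniteDimensional ℂ V']

/-- Orthogonality of matrix coefficients. -/
theorem sum_matrixCoeff_mul_matrixCoeff_eq_zero
    (hσ : IsIrred σ) (hσ' : IsIrred σ') (hniso : ¬ RepIso σ' σ.dual)
    (l : Module.Dual ℂ V) (l' : Module.Dual ℂ V') (v : V) (v' : V') :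
    ∑ g, l (σ g v) * l' (σ' g v') = 0 := by
  let T : V' →ₗ[ℂ] Module.Dual ℂ V := ∑ g, (l' ∘ₗ σ' g).smulRight (l ∘ₗ σ g)
  have hT : ∀ w' w, T w' w = ∑ g, l (σ g w) * l' (σ' g w') := fun w' w => by
    simp [T, LinearMap.sum_apply, mul_comm]
  have hzero : T = 0 := invariant_pairing_eq_zero hσ hσ' hniso T fun h w' w => by
    rw [hT, hT]
    refine Fintype.sum_equiv (Equiv.mulRight h) _ _ fun g => ?_
    simp
  rw [← hT, hzero]
  rfl

/-- Orthogonality of the functions `g ↦ tr (σ g ∘ A)` and `g ↦ tr (σ' g ∘ A')`. -/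
theorem sum_trace_mul_trace_eq_zero
    (hσ : IsIrred σ) (hσ' : IsIrred σ') (hniso : ¬ RepIso σ' σ.dual)
    (A : Module.End ℂ V) (A' : Module.End ℂ V') :
    ∑ g, LinearMap.trace ℂ V (σ g * A) * LinearMap.trace ℂ V' (σ' g * A') = 0 := by
  let b := Module.finBasis ℂ V
  let b' := Module.finBasis ℂ V'
  simp only [LinearMap.trace_eq_matrix_trace ℂ b, LinearMap.trace_eq_matrix_trace ℂ b',
    Matrix.trace, Matrix.diag_apply, LinearMap.toMatrix_apply, Module.End.mul_apply,
    Finset.sum_mul_sum]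
  rw [Finset.sum_comm]
  refine Finset.sum_eq_zero fun i _ => ?_
  rw [Finset.sum_comm]
  exact Finset.sum_eq_zero fun j _ =>
    sum_matrixCoeff_mul_matrixCoeff_eq_zero hσ hσ' hniso (b.coord i) (b'.coord j) _ _

end MatrixCoefficients

/-- The Bessel function is `g ↦ tr (σ g ∘ A)`, where `A` averages `ψ(u⁻¹) σ(u)` over `U_n(F)`. -/
theorem Bessel_eq_trace {n : ℕ} {V : Type} [AddCommGroup V] [Module ℂ V]
    (ψ : AddChar F ℂ) (σ : Representation ℂ (GLn n F) V) (g : GLn n F) :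
    Bessel ψ σ g = LinearMap.trace ℂ V (σ g *
      ((unipCount n F : ℂ)⁻¹ • ∑ u : GLn n F, if IsUnipUT u then psiU ψ u⁻¹ • σ u else 0)) := by
  simp only [Bessel, Finset.mul_sum, mul_smul_comm, map_smul, map_sum, smul_eq_mul]
  refine Finset.sum_congr rfl fun u _ => ?_
  split_ifs <;> simp

/-- If `σ` is `ψ`-generic and `σ'` is `ψ⁻¹`-generic irreducible representations of
`G_n(F)` and `σ'` is not isomorphic to the contragredient of `σ`, then
`∑_{g ∈ U_n(F)\G_n(F)} J_{σ,ψ}(g) J_{σ',ψ⁻¹}(g) = 0`. -/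
theorem bessel_sum_eq_zero_of_not_contragredient
    {n : ℕ} (ψ : AddChar F ℂ) (hψ : ψ ≠ 1)
    {V V' : Type} [AddCommGroup V] [Module ℂ V] [FiniteDimensional ℂ V]
    [AddCommGroup V'] [Module ℂ V'] [FiniteDimensional ℂ V']
    (σ : Representation ℂ (GLn n F) V) (σ' : Representation ℂ (GLn n F) V')
    (hσ : IsIrred σ) (hσ' : IsIrred σ')
    (hgen : IsGeneric ψ σ) (hgen' : IsGeneric ψ⁻¹ σ')
    (hniso : ¬ RepIso σ' σ.dual) :
    cosetSum (fun g => Bessel ψ σ g * Bessel ψ⁻¹ σ' g) = 0 := by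
  simp only [cosetSum, Bessel_eq_trace, sum_trace_mul_trace_eq_zero hσ hσ' hniso, mul_zero]
end
end

section
/- Let σ and σ′ be irreducible representations of G_n(𝔽) such that σ is ψ-generic and σ′ is ψ⁻¹-generic, with Bessel functions J_{σ,ψ} and J_{σ′,ψ⁻¹}. If σ′ is isomorphic to the contragredient σ̃ of σ, then Σ_{g ∈ U_n(𝔽)\G_n(𝔽)} J_{σ,ψ}(g)·J_{σ′,ψ⁻¹}(g) = |G_n(𝔽)| / (|U_n(𝔽)|·dim σ). -/
open scoped BigOperators
open scoped Classical

noncomputable section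

variable {F : Type} [Field F] [Fintype F] [DecidableEq F]

lemma isUnipUT_one {n : ℕ} : IsUnipUT (1 : GLn n F) :=
  ⟨fun i => by simp, fun i j hij => by simp [Matrix.one_apply_ne hij.ne']⟩

lemma IsUnipUT.mul {n : ℕ} {u v : GLn n F} (hu : IsUnipUT u) (hv : IsUnipUT v) :
    IsUnipUT (u * v) := by
  constructor
  · intro i
    rw [Units.val_mul, Matrix.mul_apply, Finset.sum_eq_single i]
    · rw [hu.1, hv.1, mul_one]
    · intro k _ hk
      rcases lt_or_gt_of_ne hk with h | h
      · rw [hu.2 i k h, zero_mul]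
      · rw [hv.2 k i h, mul_zero]
    · simp
  · intro i j hij
    rw [Units.val_mul, Matrix.mul_apply]
    refine Finset.sum_eq_zero fun k _ => ?_
    rcases lt_or_ge k i with h | h
    · rw [hu.2 i k h, zero_mul]
    · rw [hv.2 k j (hij.trans_le h), mul_zero]

lemma IsUnipUT.inv {n : ℕ} {u : GLn n F} (hu : IsUnipUT u) : IsUnipUT u⁻¹ := by
  have hpow : ∀ k : ℕ, IsUnipUT (u ^ k) := fun k => by
    induction k with
    | zero => simpa using isUnipUT_one
    | succ k ih => rw [pow_succ]; exact ih.mul hu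
  obtain ⟨k, hk⟩ := (isOfFinOrder_of_finite u).mem_powers_iff_mem_zpowers.mpr
    (inv_mem (Subgroup.mem_zpowers u))
  exact hk ▸ hpow k

lemma isUnipUT_inv_iff {n : ℕ} {u : GLn n F} : IsUnipUT u⁻¹ ↔ IsUnipUT u :=
  ⟨fun h => inv_inv u ▸ h.inv, IsUnipUT.inv⟩

lemma superdiag_mul {n : ℕ} {u v : GLn n F} (hu : IsUnipUT u) (hv : IsUnipUT v) :
    superdiag (u * v) = superdiag u + superdiag v := by
  simp only [superdiag, ← Finset.sum_add_distrib]
  refine Finset.sum_congr rfl fun i _ => Finset.sum_congr rfl fun j _ => ?_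
  split_ifs with hij
  · have hne : i ≠ j := by rintro rfl; omega
    rw [Units.val_mul, Matrix.mul_apply,
      Finset.sum_eq_add j i hne.symm _ (by simp) (by simp), hu.1, hv.1, one_mul, mul_one]
    rintro k - ⟨hkj, hki⟩
    rcases lt_or_gt_of_ne hki with h | h
    · rw [hu.2 i k h, zero_mul]
    · have : j < k := by
        rw [Fin.lt_def] at h ⊢
        have := Fin.val_ne_of_ne hkj
        omega
      rw [hv.2 k j this, mul_zero]
  · rw [add_zero]

lemma superdiag_one {n : ℕ} : superdiag (1 : GLn n F) = 0 := by
  have h := superdiag_mul (isUnipUT_one (F := F) (n := n)) isUnipUT_one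
  rw [mul_one] at h
  exact left_eq_add.mp h

lemma superdiag_inv {n : ℕ} {u : GLn n F} (hu : IsUnipUT u) :
    superdiag u⁻¹ = -superdiag u := by
  rw [eq_neg_iff_add_eq_zero, ← superdiag_mul hu.inv hu, inv_mul_cancel, superdiag_one]

lemma psiU_mul {n : ℕ} (ψ : AddChar F ℂ) {u v : GLn n F} (hu : IsUnipUT u)
    (hv : IsUnipUT v) : psiU ψ (u * v) = psiU ψ u * psiU ψ v := by
  simp only [psiU, superdiag_mul hu hv, AddChar.map_add_eq_mul]

lemma psiU_one {n : ℕ} (ψ : AddChar F ℂ) : psiU ψ (1 : GLn n F) = 1 := by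
  simp only [psiU, superdiag_one, AddChar.map_zero_eq_one]

lemma psiU_inv_mul_self {n : ℕ} (ψ : AddChar F ℂ) {u : GLn n F} (hu : IsUnipUT u) :
    psiU ψ u⁻¹ * psiU ψ u = 1 := by
  rw [← psiU_mul ψ hu.inv hu, inv_mul_cancel, psiU_one]

lemma psiU_inv_char {n : ℕ} (ψ : AddChar F ℂ) {u : GLn n F} (hu : IsUnipUT u) :
    psiU ψ⁻¹ u = psiU ψ u⁻¹ := by
  simp only [psiU, superdiag_inv hu, AddChar.inv_apply]

lemma unipCount_ne_zero (n : ℕ) : (unipCount n F : ℂ) ≠ 0 := by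
  have : Nonempty {u : GLn n F // IsUnipUT u} := ⟨⟨1, isUnipUT_one⟩⟩
  exact_mod_cast Fintype.card_ne_zero

/-- The projection `|U_n(F)|⁻¹ ∑_{u ∈ U_n(F)} ψ(u⁻¹) σ(u)` onto the Whittaker vectors. -/
def whittakerProj {n : ℕ} {V : Type} [AddCommGroup V] [Module ℂ V] (ψ : AddChar F ℂ)
    (σ : Representation ℂ (GLn n F) V) : V →ₗ[ℂ] V :=
  (unipCount n F : ℂ)⁻¹ • ∑ u : GLn n F, if IsUnipUT u then psiU ψ u⁻¹ • σ u else 0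

section Representation

variable {n : ℕ} {V : Type} [AddCommGroup V] [Module ℂ V]

lemma whittakerProj_apply (ψ : AddChar F ℂ) (σ : Representation ℂ (GLn n F) V) (x : V) :
    whittakerProj ψ σ x = (unipCount n F : ℂ)⁻¹ •
      ∑ u : GLn n F, if IsUnipUT u then psiU ψ u⁻¹ • σ u x else 0 := by
  simp only [whittakerProj, LinearMap.smul_apply, LinearMap.sum_apply]
  congr 1
  refine Finset.sum_congr rfl fun u _ => ?_
  split_ifs <;> simp

lemma whittakerProj_mem (ψ : AddChar F ℂ) (σ : Representation ℂ (GLn n F) V) (x : V) :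
    whittakerProj ψ σ x ∈ whittakerVectors ψ σ := by
  intro w hw
  rw [whittakerProj_apply, map_smul, smul_comm (psiU ψ w)]
  congr 1
  rw [map_sum, Finset.smul_sum, ← Equiv.sum_comp (Equiv.mulLeft w) (fun u => psiU ψ w • _)]
  refine Finset.sum_congr rfl fun u _ => ?_
  have hiff : IsUnipUT (w * u) ↔ IsUnipUT u :=
    ⟨fun h => by simpa using hw.inv.mul h, hw.mul⟩
  simp only [Equiv.coe_mulLeft, hiff]
  split_ifs with hu
  · rw [map_smul, smul_smul, mul_inv_rev, psiU_mul ψ hu.inv hw.inv, map_mul, mul_left_comm,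
      mul_comm (psiU ψ w), psiU_inv_mul_self ψ hw, mul_one, Module.End.mul_apply]
  · simp

lemma whittakerProj_eq_self (ψ : AddChar F ℂ) (σ : Representation ℂ (GLn n F) V) {x : V}
    (hx : x ∈ whittakerVectors ψ σ) : whittakerProj ψ σ x = x := by
  have hsum : (∑ u : GLn n F, if IsUnipUT u then psiU ψ u⁻¹ • σ u x else 0) =
      (unipCount n F : ℂ) • x := by
    have : ∀ u : GLn n F, (if IsUnipUT u then psiU ψ u⁻¹ • σ u x else 0) =
        if IsUnipUT u then x else 0 := fun u => by
      split_ifs with hu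
      · rw [hx u hu, smul_smul, psiU_inv_mul_self ψ hu, one_smul]
      · rfl
    rw [Finset.sum_congr rfl fun u _ => this u, ← Finset.sum_filter, Finset.sum_const,
      unipCount, Fintype.card_subtype, Nat.cast_smul_eq_nsmul]
  rw [whittakerProj_apply, hsum, smul_smul, inv_mul_cancel₀ (unipCount_ne_zero n), one_smul]

/-- For a generic representation the Whittaker projection has rank one. -/
lemma IsGeneric.exists_whittakerProj_eq_smulRight {ψ : AddChar F ℂ}
    {σ : Representation ℂ (GLn n F) V} (h : IsGeneric ψ σ) :
    ∃ (ℓ : V →ₗ[ℂ] ℂ) (v : V), ℓ v = 1 ∧ whittakerProj ψ σ = ℓ.smulRight v := by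
  obtain ⟨⟨v, hv⟩, hv0, hspan⟩ := finrank_eq_one_iff'.mp h
  obtain ⟨f, hf⟩ := Module.Projective.exists_dual_eq_one ℂ
    (x := v) (fun h0 => hv0 (Subtype.ext h0))
  refine ⟨f ∘ₗ whittakerProj ψ σ, v, ?_, LinearMap.ext fun x => ?_⟩
  · rw [LinearMap.comp_apply, whittakerProj_eq_self ψ σ hv, hf]
  · obtain ⟨c, hc⟩ := hspan ⟨_, whittakerProj_mem ψ σ x⟩
    replace hc : c • v = whittakerProj ψ σ x := congrArg Subtype.val hc
    rw [LinearMap.smulRight_apply, LinearMap.comp_apply, ← hc, map_smul, hf, smul_eq_mul,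
      mul_one]

lemma bessel_eq_trace (ψ : AddChar F ℂ) (σ : Representation ℂ (GLn n F) V) (g : GLn n F) :
    Bessel ψ σ g = LinearMap.trace ℂ V (σ g * whittakerProj ψ σ) := by
  rw [Bessel, whittakerProj, mul_smul_comm, map_smul, smul_eq_mul]
  congr 1
  rw [Finset.mul_sum, map_sum]
  refine Finset.sum_congr rfl fun u _ => ?_
  split_ifs
  · rw [mul_smul_comm, map_smul, smul_eq_mul, map_mul]
  · simp

lemma RepIso.trace_eq {G W : Type} [Group G] [AddCommGroup W] [Module ℂ W]
    {σ : Representation ℂ G V} {τ : Representation ℂ G W} (h : RepIso σ τ) (g : G) :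
    LinearMap.trace ℂ V (σ g) = LinearMap.trace ℂ W (τ g) := by
  obtain ⟨e, he⟩ := h
  rw [← LinearMap.trace_conj' (σ g) e]
  congr 1
  ext w
  simp [LinearEquiv.conj_apply, he]

variable [FiniteDimensional ℂ V]

lemma bessel_contragredient {V' : Type} [AddCommGroup V'] [Module ℂ V']
    (ψ : AddChar F ℂ) (σ : Representation ℂ (GLn n F) V)
    (σ' : Representation ℂ (GLn n F) V') (h : RepIso σ' σ.dual) (g : GLn n F) :
    Bessel ψ⁻¹ σ' g = Bessel ψ σ g⁻¹ := by
  rw [Bessel, Bessel, ← Equiv.sum_comp (Equiv.inv (GLn n F))]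
  congr 1
  refine Finset.sum_congr rfl fun u _ => ?_
  simp only [Equiv.inv_apply, isUnipUT_inv_iff, inv_inv]
  split_ifs with hu
  · have htr : LinearMap.trace ℂ V' (σ' (g * u⁻¹)) = LinearMap.trace ℂ V (σ (g⁻¹ * u)) := by
      rw [h.trace_eq, Representation.dual_apply, LinearMap.trace_transpose', mul_inv_rev,
        inv_inv, map_mul σ, map_mul σ, LinearMap.trace_mul_comm]
    rw [psiU_inv_char ψ hu, htr]
  · rfl

/-- Schur's lemma for the average of an endomorphism over the group. -/
lemma IsIrred.sum_conj_eq {G : Type} [Group G] [Fintype G] {σ : Representation ℂ G V}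
    (hσ : IsIrred σ) (X : Module.End ℂ V) :
    ∑ g : G, σ g * X * σ g⁻¹ =
      ((Fintype.card G : ℂ) / Module.finrank ℂ V * LinearMap.trace ℂ V X) •
        (1 : Module.End ℂ V) := by
  have := hσ.1
  set T : Module.End ℂ V := ∑ g : G, σ g * X * σ g⁻¹ with hT
  have hcomm : ∀ h : G, σ h * T = T * σ h := fun h => by
    rw [hT, Finset.mul_sum, Finset.sum_mul,
      ← Equiv.sum_comp (Equiv.mulLeft h) (fun g => σ g * X * σ g⁻¹ * σ h)]
    refine Finset.sum_congr rfl fun g _ => ?_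
    simp only [Equiv.coe_mulLeft, mul_assoc, ← map_mul, mul_inv_rev, inv_mul_cancel, mul_one]
    simp only [← mul_assoc, ← map_mul]
  obtain ⟨c, hc⟩ := Module.End.exists_eigenvalue T
  have htop : T.eigenspace c = ⊤ := by
    refine (hσ.2 _ fun g v hv => ?_).resolve_left hc
    rw [Module.End.mem_eigenspace_iff] at hv ⊢
    rw [← Module.End.mul_apply, ← hcomm, Module.End.mul_apply, hv, map_smul]
  have hTc : T = c • (1 : Module.End ℂ V) := LinearMap.ext fun v =>
    Module.End.mem_eigenspace_iff.mp (htop ▸ Submodule.mem_top)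
  have htr : LinearMap.trace ℂ V T = Fintype.card G * LinearMap.trace ℂ V X := by
    have : ∀ g : G, LinearMap.trace ℂ V (σ g * X * σ g⁻¹) = LinearMap.trace ℂ V X := fun g => by
      rw [LinearMap.trace_mul_comm, ← mul_assoc, ← map_mul, inv_mul_cancel, map_one, one_mul]
    rw [hT, map_sum, Finset.sum_congr rfl fun g _ => this g]
    simp
  have hd : (Module.finrank ℂ V : ℂ) ≠ 0 := by exact_mod_cast Module.finrank_pos.ne'
  rw [hTc, map_smul, LinearMap.trace_one, smul_eq_mul] at htr
  rw [hTc, div_mul_eq_mul_div, ← htr, mul_div_cancel_right₀ _ hd]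

end Representation

/-- If `σ` is `ψ`-generic and `σ'` is `ψ⁻¹`-generic irreducible representations of
`G_n(F)` and `σ'` is isomorphic to the contragredient of `σ`, then
`∑_{g ∈ U_n(F)\G_n(F)} J_{σ,ψ}(g) J_{σ',ψ⁻¹}(g) = |G_n(F)| / (|U_n(F)| · dim σ)`. -/
theorem bessel_sum_of_contragredient
    {n : ℕ} (ψ : AddChar F ℂ) (hψ : ψ ≠ 1)
    {V V' : Type} [AddCommGroup V] [Module ℂ V] [FiniteDimensional ℂ V]
    [AddCommGroup V'] [Module ℂ V'] [FiniteDimensional ℂ V']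
    (σ : Representation ℂ (GLn n F) V) (σ' : Representation ℂ (GLn n F) V')
    (hσ : IsIrred σ) (hσ' : IsIrred σ')
    (hgen : IsGeneric ψ σ) (hgen' : IsGeneric ψ⁻¹ σ')
    (hiso : RepIso σ' σ.dual) :
    cosetSum (fun g => Bessel ψ σ g * Bessel ψ⁻¹ σ' g) =
      (Fintype.card (GLn n F) : ℂ) / ((unipCount n F : ℂ) * (Module.finrank ℂ V : ℂ)) := by
  obtain ⟨ℓ, v, hv, hP⟩ := hgen.exists_whittakerProj_eq_smulRight
  have hJ : ∀ g, Bessel ψ σ g = ℓ (σ g v) := fun g => by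
    have : σ g * ℓ.smulRight v = ℓ.smulRight (σ g v) := LinearMap.ext fun x => by simp
    rw [bessel_eq_trace, hP, this, LinearMap.trace_smulRight]
  have hsum : ∑ g : GLn n F, Bessel ψ σ g * Bessel ψ⁻¹ σ' g =
      (Fintype.card (GLn n F) : ℂ) / Module.finrank ℂ V := by
    have h := congrArg (fun A : Module.End ℂ V => ℓ (A v)) (hσ.sum_conj_eq (ℓ.smulRight v))
    simp only [LinearMap.trace_smulRight, hv, mul_one, LinearMap.smul_apply,
      Module.End.one_apply, map_smul, smul_eq_mul, LinearMap.sum_apply, map_sum,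
      Module.End.mul_apply, LinearMap.smulRight_apply] at h
    rw [← h]
    refine Finset.sum_congr rfl fun g _ => ?_
    rw [bessel_contragredient ψ σ σ' hiso, hJ, hJ, mul_comm]
  rw [cosetSum, hsum, inv_mul_eq_div, div_div, mul_comm (Module.finrank ℂ V : ℂ)]
end
end

section
/- Let t ≥ 1 and let H: G_t(𝔽) → ℂ be a function satisfying: (i) H(ug) = ψ(u)H(g) for all u ∈ U_t(𝔽) and g ∈ G_t(𝔽); and (ii) Σ_{u ∈ U′} H(gux) = 0 for every nontrivial standard unipotent subgroup U′ ⊆ G_t(𝔽) and all g, x ∈ G_t(𝔽). If Σ_{g ∈ U_t(𝔽)\G_t(𝔽)} H(g)·W_τ(g) = 0 for every irreducible cuspidal representation τ of G_t(𝔽) and every W_τ ∈ 𝒲(τ, ψ⁻¹), then H is identically zero. -/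
open scoped BigOperators
open scoped Classical

noncomputable section

variable {F : Type} [Field F] [Fintype F] [DecidableEq F]

/-- The right regular representation of `G` on the functions `G → ℂ`. -/
def rightRegular (G : Type) [Group G] : Representation ℂ G (G → ℂ) where
  toFun g :=
    { toFun := fun f x => f (x * g)
      map_add' := fun _ _ => rfl
      map_smul' := fun _ _ => rfl }
  map_one' := by
    ext f x
    simp
  map_mul' g h := by
    ext f x
    simp [mul_assoc]

@[simp]
lemma rightRegular_apply {G : Type} [Group G] (g : G) (f : G → ℂ) (x : G) :
    rightRegular G g f x = f (x * g) := rfl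

/-- The restriction of a representation to an invariant subspace. -/
def restrictRep {G : Type} [Group G] {V : Type} [AddCommGroup V] [Module ℂ V]
    (σ : Representation ℂ G V) (U : Submodule ℂ V) (hU : ∀ g, ∀ v ∈ U, σ g v ∈ U) :
    Representation ℂ G U where
  toFun g := (σ g).restrict (hU g)
  map_one' := by
    ext v
    simp
  map_mul' g h := by
    ext v
    simp

@[simp]
lemma restrictRep_apply_coe {G : Type} [Group G] {V : Type} [AddCommGroup V] [Module ℂ V]
    (σ : Representation ℂ G V) (U : Submodule ℂ V) (hU : ∀ g, ∀ v ∈ U, σ g v ∈ U)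
    (g : G) (v : U) : (restrictRep σ U hU g v : V) = σ g v := rfl

/-- A nonzero invariant subspace of a finite-dimensional representation contains an
irreducible one. -/
lemma exists_irreducible_le {G : Type} [Group G] {V : Type} [AddCommGroup V] [Module ℂ V]
    [FiniteDimensional ℂ V] (σ : Representation ℂ G V) (T : Submodule ℂ V) (hT : T ≠ ⊥)
    (hinv : ∀ g, ∀ v ∈ T, σ g v ∈ T) :
    ∃ (U : Submodule ℂ V) (hU : ∀ g, ∀ v ∈ U, σ g v ∈ U),
      U ≤ T ∧ IsIrred (restrictRep σ U hU) := by
  obtain ⟨U, ⟨hUT, hU0, hU⟩, hmin⟩ := wellFounded_lt.has_min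
    {U : Submodule ℂ V | U ≤ T ∧ U ≠ ⊥ ∧ ∀ g, ∀ v ∈ U, σ g v ∈ U} ⟨T, le_rfl, hT, hinv⟩
  refine ⟨U, hU, hUT, Submodule.nontrivial_iff_ne_bot.mpr hU0, fun Y hY => ?_⟩
  by_contra! h
  have hle : Y.map U.subtype ≤ U := Submodule.map_subtype_le U Y
  refine hmin (Y.map U.subtype) ⟨hle.trans hUT, ?_, ?_⟩ (lt_of_le_of_ne hle ?_)
  · rw [← Submodule.map_bot U.subtype]
    exact (Submodule.map_injective_of_injective U.injective_subtype).ne h.1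
  · rintro g _ ⟨y, hy, rfl⟩
    exact ⟨restrictRep σ U hU g y, hY g y hy, rfl⟩
  · intro heq
    refine h.2 (Submodule.map_injective_of_injective U.injective_subtype ?_)
    rw [heq, Submodule.map_subtype_top]

/-- A function in an invariant subspace of the regular representation which is orthogonal to
every irreducible subspace of it vanishes. -/
lemma eq_zero_of_orthogonal_to_irreducibles {G : Type} [Group G] [Fintype G]
    (V₀ : Submodule ℂ (G → ℂ)) (hV₀ : ∀ g, ∀ f ∈ V₀, rightRegular G g f ∈ V₀)
    (f : G → ℂ) (hf : f ∈ V₀)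
    (horth : ∀ (U : Submodule ℂ (G → ℂ)) (hU : ∀ g, ∀ v ∈ U, rightRegular G g v ∈ U),
      U ≤ V₀ → IsIrred (restrictRep (rightRegular G) U hU) →
      ∀ w ∈ U, ∑ x, f x * star (w x) = 0) :
    f = 0 := by
  let T : Submodule ℂ (G → ℂ) :=
    { carrier := {h | h ∈ V₀ ∧ ∀ (U : Submodule ℂ (G → ℂ))
        (hU : ∀ g, ∀ v ∈ U, rightRegular G g v ∈ U),
        U ≤ V₀ → IsIrred (restrictRep (rightRegular G) U hU) →
        ∀ w ∈ U, ∑ x, h x * star (w x) = 0}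
      add_mem' := fun {a b} ha hb => ⟨V₀.add_mem ha.1 hb.1, fun U hU hle hirr w hw => by
        simp only [Pi.add_apply, add_mul, Finset.sum_add_distrib]
        rw [ha.2 U hU hle hirr w hw, hb.2 U hU hle hirr w hw, add_zero]⟩
      zero_mem' := ⟨V₀.zero_mem, fun U hU hle hirr w hw => by simp⟩
      smul_mem' := fun c a ha => ⟨V₀.smul_mem c ha.1, fun U hU hle hirr w hw => by
        simp only [Pi.smul_apply, smul_eq_mul, mul_assoc]
        rw [← Finset.mul_sum, ha.2 U hU hle hirr w hw, mul_zero]⟩ }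
  have hT : ∀ g, ∀ h ∈ T, rightRegular G g h ∈ T := by
    rintro g h ⟨hh, ho⟩
    refine ⟨hV₀ g h hh, fun U hU hle hirr w hw => ?_⟩
    rw [← ho U hU hle hirr _ (hU g⁻¹ w hw)]
    exact Fintype.sum_equiv (Equiv.mulRight g) _ _ fun x => by simp
  by_contra hne
  have hT0 : T ≠ ⊥ := fun h => hne ((Submodule.mem_bot ℂ).mp (h ▸ (⟨hf, horth⟩ : f ∈ T)))
  obtain ⟨U, hU, hUT, hirr⟩ := exists_irreducible_le (rightRegular G) T hT0 hT
  obtain ⟨w, hw, hw0⟩ := U.exists_mem_ne_zero_of_ne_bot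
    (Submodule.nontrivial_iff_ne_bot.mp hirr.1)
  open scoped ComplexOrder in
  exact hw0 (dotProduct_self_star_eq_zero.mp
    ((hUT hw).2 U hU (fun v hv => (hUT hv).1) hirr w hw))

lemma psiU_inv {K : Type} [Field K] [Fintype K] {n : ℕ} (ψ : AddChar K ℂ) (u : GLn n K) :
    psiU ψ⁻¹ u = star (psiU ψ u) := by
  simp [psiU, AddChar.inv_apply, AddChar.map_neg_eq_conj]

/-- The functions on `GL_t(F)` which are left `ψ`-equivariant under `U_t(F)` and whose sums
over translates of nontrivial standard unipotent subgroups vanish. -/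
def cuspidalWhittakerFunctions (t : ℕ) (ψ : AddChar F ℂ) : Submodule ℂ (GLn t F → ℂ) where
  carrier := {f | (∀ u g : GLn t F, IsUnipUT u → f (u * g) = psiU ψ u * f g) ∧
    ∀ c : Fin t → ℕ, Monotone c → (∃ i j, c i ≠ c j) → ∀ g x : GLn t F,
      (∑ u : GLn t F, if InStdUnip c u then f (g * u * x) else 0) = 0}
  add_mem' := by
    rintro a b ⟨ha, ha'⟩ ⟨hb, hb'⟩
    refine ⟨fun u g hu => by simp [ha u g hu, hb u g hu, mul_add], fun c hc hij g x => ?_⟩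
    have h := congrArg₂ (· + ·) (ha' c hc hij g x) (hb' c hc hij g x)
    simp only [← Finset.sum_add_distrib, add_zero] at h
    refine Eq.trans (Finset.sum_congr rfl fun u _ => ?_) h
    split_ifs <;> simp
  zero_mem' := by simp
  smul_mem' := by
    rintro k a ⟨ha, ha'⟩
    refine ⟨fun u g hu => by simp [ha u g hu, mul_left_comm], fun c hc hij g x => ?_⟩
    have h := congrArg (k * ·) (ha' c hc hij g x)
    simp only [Finset.mul_sum, mul_zero] at h
    refine Eq.trans (Finset.sum_congr rfl fun u _ => ?_) h
    split_ifs <;> simp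

lemma rightRegular_mem_cuspidalWhittakerFunctions {t : ℕ} (ψ : AddChar F ℂ) (g : GLn t F)
    (f : GLn t F → ℂ) (hf : f ∈ cuspidalWhittakerFunctions t ψ) :
    rightRegular (GLn t F) g f ∈ cuspidalWhittakerFunctions t ψ := by
  refine ⟨fun u x hu => ?_, fun c hc hij y x => ?_⟩
  · simp only [rightRegular_apply, mul_assoc]
    exact hf.1 u (x * g) hu
  · simpa only [rightRegular_apply, mul_assoc] using hf.2 c hc hij y (x * g)

lemma star_mem_cuspidalWhittakerFunctions {t : ℕ} (ψ : AddChar F ℂ)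
    (f : GLn t F → ℂ) (hf : f ∈ cuspidalWhittakerFunctions t ψ) :
    star f ∈ cuspidalWhittakerFunctions t ψ⁻¹ := by
  refine ⟨fun u g hu => ?_, fun c hc hij g x => ?_⟩
  · simp only [Pi.star_apply, hf.1 u g hu, psiU_inv, star_mul']
  · have h := congrArg star (hf.2 c hc hij g x)
    rw [star_sum, star_zero] at h
    refine Eq.trans (Finset.sum_congr rfl fun u _ => ?_) h
    split_ifs <;> simp

/-- Irreducible subspaces of the space of cuspidal Whittaker functions are cuspidal. -/
lemma isCuspidal_restrictRep {t : ℕ} (ψ : AddChar F ℂ) (U : Submodule ℂ (GLn t F → ℂ))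
    (hU : ∀ g, ∀ v ∈ U, rightRegular (GLn t F) g v ∈ U)
    (hle : U ≤ cuspidalWhittakerFunctions t ψ)
    (hirr : IsIrred (restrictRep (rightRegular (GLn t F)) U hU)) :
    IsCuspidal (restrictRep (rightRegular (GLn t F)) U hU) := by
  refine ⟨hirr, fun c hc hij => LinearMap.ext fun f => Subtype.ext (funext fun g => ?_)⟩
  have h := (hle f.2).2 c hc hij g 1
  simp only [mul_one] at h
  rw [LinearMap.sum_apply, Submodule.coe_sum, Finset.sum_apply]
  refine Eq.trans (Finset.sum_congr rfl fun u _ => ?_) h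
  split_ifs <;> simp

/-- Functions in an invariant space of Whittaker functions belong to its Whittaker model, via
evaluation at the identity. -/
lemma isWhittaker_restrictRep {t : ℕ} (ψ : AddChar F ℂ) (U : Submodule ℂ (GLn t F → ℂ))
    (hU : ∀ g, ∀ v ∈ U, rightRegular (GLn t F) g v ∈ U)
    (hle : U ≤ cuspidalWhittakerFunctions t ψ) (f : GLn t F → ℂ) (hf : f ∈ U) :
    IsWhittaker ψ (restrictRep (rightRegular (GLn t F)) U hU) f := by
  refine ⟨(LinearMap.proj 1).comp U.subtype, ⟨f, hf⟩, fun u hu w => ?_, fun g => by simp⟩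
  simpa using (hle w.2).1 u 1 hu

/-- If `H : G_t(F) → ℂ` satisfies `H(ug) = ψ(u)H(g)`, has vanishing sums over
translates of every nontrivial standard unipotent subgroup, and is orthogonal to all `ψ⁻¹`
Whittaker functions of all irreducible cuspidal representations of `G_t(F)`, then `H ≡ 0`. -/
theorem vanishing_of_orthogonal_to_cuspidal
    {t : ℕ} (ht : 1 ≤ t) (ψ : AddChar F ℂ) (hψ : ψ ≠ 1)
    (H : GLn t F → ℂ)
    (h1 : ∀ u g : GLn t F, IsUnipUT u → H (u * g) = psiU ψ u * H g)
    (h2 : ∀ c : Fin t → ℕ, Monotone c → (∃ i j, c i ≠ c j) →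
      ∀ g x : GLn t F,
        (∑ u : GLn t F, if InStdUnip c u then H (g * u * x) else 0) = 0)
    (h3 : ∀ (V : Type) [AddCommGroup V] [Module ℂ V] [FiniteDimensional ℂ V]
      (τ : Representation ℂ (GLn t F) V), IsCuspidal τ →
      ∀ W : GLn t F → ℂ, IsWhittaker ψ⁻¹ τ W →
        cosetSum (fun g => H g * W g) = 0) :
    H = 0 := by
  have hcount : (unipCount t F : ℂ)⁻¹ ≠ 0 := by
    have h : IsUnipUT (1 : GLn t F) :=
      ⟨fun i => by simp, fun i j hij => by simp [Matrix.one_apply_ne hij.ne']⟩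
    exact inv_ne_zero (Nat.cast_ne_zero.mpr (Fintype.card_pos_iff.mpr ⟨1, h⟩).ne')
  refine star_eq_zero.mp (eq_zero_of_orthogonal_to_irreducibles
    (cuspidalWhittakerFunctions t ψ⁻¹) (rightRegular_mem_cuspidalWhittakerFunctions ψ⁻¹)
    (star H) (star_mem_cuspidalWhittakerFunctions ψ H ⟨h1, h2⟩) fun U hU hle hirr w hw => ?_)
  have h := (mul_eq_zero.mp (h3 U _ (isCuspidal_restrictRep ψ⁻¹ U hU hle hirr) w
    (isWhittaker_restrictRep ψ⁻¹ U hU hle w hw))).resolve_left hcount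
  simpa only [star_sum, star_mul', star_zero, Pi.star_apply] using congrArg star h
end
end
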